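/- Let a be a real number with 1/2 < a < 1, let d > 0, set n = 2d(1−a) and y₊ = (1/2)·√((2a−1)/(2−a)). Then the Hessian matrix of F at the point (1, 1, y₊) (a real symmetric 3×3 matrix) has exactly two positive eigenvalues and exactly one negative eigenvalue; equivalently, the Einstein metric g3 = (1,1,1,y₊) is a non-degenerate unstable critical point of the normalized scalar curvature with coindex 2. -/

import Mathlib

open Real

/-- Scalar curvature of the invariant metric `g = (x1,x2,x3,x4)` on `M = H×H/ΔK`,
where `d = dim K` and `n = dim H/K`. -/
noncomputable def Scal (d n x1 x2 x3 x4 : ℝ) : ℝ :=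
  d / (2 * x3) -
    n * (x2 ^ 2 * x3 ^ 2 + x1 ^ 2 * (4 * x2 ^ 2 - 8 * x2 * x3 + x3 ^ 2)
        + 8 * x2 * x3 * x4 ^ 2 + 8 * x1 * x3 * (x4 ^ 2 - x2 ^ 2)
        - 2 * x4 ^ 2 * (x3 ^ 2 + 2 * x4 ^ 2)) /
      (16 * x3 * (x4 ^ 2 - x1 * x2) ^ 2)

/-- Normalized scalar curvature `F(x1,x2,x4) = Scal(x1,x2,1,x4)·(x1·x2 − x4²)^{n/(d+2n)}`. -/
noncomputable def F (d n x1 x2 x4 : ℝ) : ℝ :=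
  Scal d n x1 x2 1 x4 * (x1 * x2 - x4 ^ 2) ^ (n / (d + 2 * n))

/-- Partial derivative of a function of three real variables in the `i`-th variable. -/
noncomputable def pd (i : Fin 3) (f : ℝ → ℝ → ℝ → ℝ) : ℝ → ℝ → ℝ → ℝ :=
  ![fun x y z => deriv (fun t => f t y z) x,
    fun x y z => deriv (fun t => f x t z) y,
    fun x y z => deriv (fun t => f x y t) z] i

/-- Hessian matrix of second-order partial derivatives at `(x, y, z)`. -/
noncomputable def Hess (f : ℝ → ℝ → ℝ → ℝ) (x y z : ℝ) : Matrix (Fin 3) (Fin 3) ℝ :=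
  Matrix.of fun i j => pd i (pd j f) x y z

open Polynomial in
/-- A real symmetric `3 × 3` matrix invariant under swapping the first two coordinates, which is
positive on the antisymmetric line and indefinite on the symmetric plane, has two positive
eigenvalues and one negative eigenvalue. -/
theorem card_filter_roots_charpoly_of_swap_invariant {α β γ δ : ℝ} (h₁ : 0 < α - β)
    (h₂ : (α + β) * δ < 2 * γ ^ 2) :
    ((!![α, β, γ; β, α, γ; γ, γ, δ] : Matrix (Fin 3) (Fin 3) ℝ).charpoly.roots.filter
      (fun x => 0 < x)).card = 2 ∧
    ((!![α, β, γ; β, α, γ; γ, γ, δ] : Matrix (Fin 3) (Fin 3) ℝ).charpoly.roots.filter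
      (fun x => x < 0)).card = 1 := by
  obtain ⟨u, v, hu, hv, hsum, hprod⟩ :
      ∃ u v : ℝ, 0 < u ∧ v < 0 ∧ u + v = α + β + δ ∧ u * v = (α + β) * δ - 2 * γ ^ 2 := by
    set b := α + β + δ
    set e := 2 * γ ^ 2 - (α + β) * δ
    have he : 0 < e := by simp only [e]; linarith
    have hs : √(b ^ 2 + 4 * e) ^ 2 = b ^ 2 + 4 * e := Real.sq_sqrt (by positivity)
    have hlt : |b| < √(b ^ 2 + 4 * e) := by
      rw [← Real.sqrt_sq_eq_abs]
      exact Real.sqrt_lt_sqrt (sq_nonneg b) (by linarith)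
    obtain ⟨h₃, h₄⟩ := abs_lt.1 hlt
    refine ⟨(b + √(b ^ 2 + 4 * e)) / 2, (b - √(b ^ 2 + 4 * e)) / 2, by linarith, by linarith,
      by ring, ?_⟩
    simp only [e] at hs ⊢
    linear_combination -hs / 4
  have hchar : (!![α, β, γ; β, α, γ; γ, γ, δ] : Matrix (Fin 3) (Fin 3) ℝ).charpoly =
      ((({α - β, u, v} : Multiset ℝ)).map fun r => X - C r).prod := by
    have hsum' : (C u + C v : ℝ[X]) = C α + C β + C δ := by simp only [← C_add, hsum]
    have hprod' : (C u * C v : ℝ[X]) = (C α + C β) * C δ - 2 * C γ ^ 2 := by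
      rw [← C_mul, hprod]; simp only [map_sub, map_mul, map_add, map_pow, map_ofNat]
    simp only [Matrix.charpoly, Matrix.det_fin_three, Matrix.charmatrix_apply]
    simp
    linear_combination (X - (C α - C β)) * X * hsum' - (X - (C α - C β)) * hprod'
  rw [hchar, roots_multiset_prod_X_sub_C]
  simp [Multiset.filter_singleton, h₁, hu, hv, not_lt.2 h₁.le, not_lt.2 hu.le, not_lt.2 hv.le,
    -sub_pos, -sub_neg]

/-- The `i`-th partial derivative of `x * y - z ^ 2`. -/
def detGrad (i : Fin 3) (x y z : ℝ) : ℝ := ![y, x, -2 * z] i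

/-- The polynomial `Q` such that `F = Q · (x * y - z ^ 2) ^ (n / (d + 2 * n) - 2)`. -/
noncomputable def scalNum (d n x y z : ℝ) : ℝ :=
  (d / 2 - n / 4) * (x * y - z ^ 2) ^ 2 -
    n / 16 * ((x - y) ^ 2 + (2 + 8 * z ^ 2 - 8 * (x + y)) * (x * y - z ^ 2))

/-- The `i`-th partial derivative of `scalNum`. -/
noncomputable def scalNumGrad (d n : ℝ) (i : Fin 3) (x y z : ℝ) : ℝ :=
  (d / 2 - n / 4) * (2 * (x * y - z ^ 2) * detGrad i x y z) -
    n / 16 * (![2 * (x - y), -2 * (x - y), 0] i + ![-8, -8, 16 * z] i * (x * y - z ^ 2) +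
      (2 + 8 * z ^ 2 - 8 * (x + y)) * detGrad i x y z)

theorem F_eq_scalNum_mul_rpow (d n : ℝ) {x y z : ℝ} (h : 0 < x * y - z ^ 2) :
    F d n x y z = scalNum d n x y z * (x * y - z ^ 2) ^ (n / (d + 2 * n) - 2) := by
  rw [F, Scal, scalNum, ← neg_sub (x * y), neg_sq, Real.rpow_sub h, Real.rpow_two]
  generalize (x * y - z ^ 2) ^ (n / (d + 2 * n)) = R
  set E := x * y - z ^ 2 with hE
  have hE0 : E ≠ 0 := h.ne'
  field_simp
  rw [hE]
  ring

theorem HasDerivAt.mul_rpow_of_pos {P E : ℝ → ℝ} {P' E' t r : ℝ} (hP : HasDerivAt P P' t)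
    (hE : HasDerivAt E E' t) (h : 0 < E t) :
    HasDerivAt (fun s => P s * E s ^ r) ((P' * E t + r * P t * E') * E t ^ (r - 1)) t := by
  refine (hP.mul (hE.rpow_const (p := r) (Or.inl h.ne'))).congr_deriv ?_
  rw [Real.rpow_sub_one h.ne']
  field_simp

theorem pd_eq_of_eq_mul_rpow {f P : ℝ → ℝ → ℝ → ℝ} {r : ℝ}
    (hf : ∀ x y z, 0 < x * y - z ^ 2 → f x y z = P x y z * (x * y - z ^ 2) ^ r)
    (hP : Differentiable ℝ fun v : ℝ × ℝ × ℝ => P v.1 v.2.1 v.2.2)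
    (i : Fin 3) {x y z : ℝ} (h : 0 < x * y - z ^ 2) :
    pd i f x y z = (pd i P x y z * (x * y - z ^ 2) + r * P x y z * detGrad i x y z) *
      (x * y - z ^ 2) ^ (r - 1) := by
  fin_cases i
  · have hd : DifferentiableAt ℝ (fun t => P t y z) x :=
      (hP (x, y, z)).comp (f := fun t : ℝ => (t, y, z)) x (by fun_prop)
    have hE : HasDerivAt (fun t => t * y - z ^ 2) y x := by
      simpa using ((hasDerivAt_id x).mul_const y).sub_const (z ^ 2)
    have hev : (fun t => f t y z) =ᶠ[nhds x] fun t => P t y z * (t * y - z ^ 2) ^ r := by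
      filter_upwards [hE.continuousAt.eventually (lt_mem_nhds h)] with t ht using hf _ _ _ ht
    exact hev.deriv_eq.trans (hd.hasDerivAt.mul_rpow_of_pos hE h).deriv
  · have hd : DifferentiableAt ℝ (fun t => P x t z) y :=
      (hP (x, y, z)).comp (f := fun t : ℝ => (x, t, z)) y (by fun_prop)
    have hE : HasDerivAt (fun t => x * t - z ^ 2) x y := by
      simpa using ((hasDerivAt_id y).const_mul x).sub_const (z ^ 2)
    have hev : (fun t => f x t z) =ᶠ[nhds y] fun t => P x t z * (x * t - z ^ 2) ^ r := by
      filter_upwards [hE.continuousAt.eventually (lt_mem_nhds h)] with t ht using hf _ _ _ ht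
    exact hev.deriv_eq.trans (hd.hasDerivAt.mul_rpow_of_pos hE h).deriv
  · have hd : DifferentiableAt ℝ (fun t => P x y t) z :=
      (hP (x, y, z)).comp (f := fun t : ℝ => (x, y, t)) z (by fun_prop)
    have hE : HasDerivAt (fun t => x * y - t ^ 2) (-2 * z) z := by
      simpa using ((hasDerivAt_id z).pow 2).const_sub (x * y)
    have hev : (fun t => f x y t) =ᶠ[nhds z] fun t => P x y t * (x * y - t ^ 2) ^ r := by
      filter_upwards [hE.continuousAt.eventually (lt_mem_nhds h)] with t ht using hf _ _ _ ht
    exact hev.deriv_eq.trans (hd.hasDerivAt.mul_rpow_of_pos hE h).deriv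

theorem pd_scalNum (d n : ℝ) (i : Fin 3) (x y z : ℝ) :
    pd i (scalNum d n) x y z = scalNumGrad d n i x y z := by
  fin_cases i <;>
    simp (disch := fun_prop) [pd, scalNum, scalNumGrad, detGrad, deriv_fun_add, deriv_fun_sub,
      deriv_fun_mul, deriv_fun_pow, -mul_eq_mul_left_iff,
      -mul_eq_mul_right_iff] <;>
    ring

theorem pd_F (d n : ℝ) (j : Fin 3) {x y z : ℝ} (h : 0 < x * y - z ^ 2) :
    pd j (F d n) x y z =
      (scalNumGrad d n j x y z * (x * y - z ^ 2) +
        (n / (d + 2 * n) - 2) * scalNum d n x y z * detGrad j x y z) *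
      (x * y - z ^ 2) ^ (n / (d + 2 * n) - 2 - 1) := by
  rw [pd_eq_of_eq_mul_rpow (P := scalNum d n) (fun _ _ _ h => F_eq_scalNum_mul_rpow d n h)
    (by unfold scalNum; fun_prop) j h, pd_scalNum]

theorem hess_F_apply (d n : ℝ) (i j : Fin 3) {x y z : ℝ} (h : 0 < x * y - z ^ 2) :
    Hess (F d n) x y z i j =
      (pd i (fun x y z => scalNumGrad d n j x y z * (x * y - z ^ 2) +
          (n / (d + 2 * n) - 2) * scalNum d n x y z * detGrad j x y z) x y z * (x * y - z ^ 2) +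
        (n / (d + 2 * n) - 2 - 1) * (scalNumGrad d n j x y z * (x * y - z ^ 2) +
          (n / (d + 2 * n) - 2) * scalNum d n x y z * detGrad j x y z) * detGrad i x y z) *
      (x * y - z ^ 2) ^ (n / (d + 2 * n) - 2 - 1 - 1) := by
  refine pd_eq_of_eq_mul_rpow (fun _ _ _ h => pd_F d n j h) ?_ i h
  fin_cases j <;> simp [scalNumGrad, scalNum, detGrad] <;> fun_prop

set_option maxHeartbeats 2000000 in
/-- The Hessian of `F` at `(1, 1, y)` when `n = d (1 - 4 y²) / (1 + 2 y²)`, i.e. at the Einstein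
metric. -/
theorem hess_F_einstein {d n y : ℝ} (hd : 0 < d) (hy : 4 * y ^ 2 < 1)
    (hn : n = d * (1 - 4 * y ^ 2) / (1 + 2 * y ^ 2)) {c L k : ℝ} (hc : c = n / 16)
    (hL : L = d * (1 - 4 * y ^ 2) / (4 * (1 - 2 * y ^ 2) * (1 + 2 * y ^ 2)))
    (hk : k = (1 - y ^ 2) ^ (n / (d + 2 * n) - 2)) :
    Hess (F d n) 1 1 y =
      !![(L - 2 * c) * k, (L - 6 * c + 8 * c * y ^ 2) * k, -2 * y * L * k;
        (L - 6 * c + 8 * c * y ^ 2) * k, (L - 2 * c) * k, -2 * y * L * k;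
        -2 * y * L * k, -2 * y * L * k, 4 * y ^ 2 * L * k] := by
  have h₁ : 0 < 1 + 2 * y ^ 2 := by positivity
  have h₂ : 0 < 1 - 2 * y ^ 2 := by linarith
  have h₃ : 0 < 1 - y ^ 2 := by nlinarith
  have hp : n / (d + 2 * n) = (1 - 4 * y ^ 2) / (3 * (1 - 2 * y ^ 2)) := by
    have h₄ : d + 2 * n = 3 * d * (1 - 2 * y ^ 2) / (1 + 2 * y ^ 2) := by
      rw [hn]; field_simp; ring
    rw [h₄, hn]
    field_simp
  have hpos : 0 < (1 : ℝ) * 1 - y ^ 2 := by linarith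
  have hk' : ((1 : ℝ) * 1 - y ^ 2) ^ (n / (d + 2 * n) - 2 - 1 - 1) = k / (1 - y ^ 2) ^ 2 := by
    rw [one_mul, Real.rpow_sub_one h₃.ne', Real.rpow_sub_one h₃.ne', hk, div_div, ← sq]
  ext i j
  rw [hess_F_apply d n i j hpos, hk', hp, hL, hc, hn]
  clear hk' hk hp hL hc hn
  fin_cases i <;> fin_cases j <;>
    simp (disch := fun_prop) [pd, scalNum, scalNumGrad, detGrad, deriv_fun_add, deriv_fun_sub,
      deriv_fun_mul, deriv_fun_pow, -mul_eq_mul_left_iff,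
      -mul_eq_mul_right_iff] <;>
    field_simp <;>
    ring

/-- The Hessian of `F` at `(1, 1, y₊)` is a real symmetric matrix having exactly two
positive eigenvalues and exactly one negative eigenvalue (counted with multiplicity,
as roots of the characteristic polynomial): the Einstein metric `g3` is a non-degenerate
unstable critical point of the normalized scalar curvature of coindex 2. -/
theorem g3_coindex_two (a d n y : ℝ) (ha1 : 1/2 < a) (ha2 : a < 1) (hd : 0 < d)
    (hn : n = 2 * d * (1 - a))
    (hy : y = (1/2) * Real.sqrt ((2 * a - 1) / (2 - a))) :
    (Hess (F d n) 1 1 y).IsHermitian ∧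
    ((Hess (F d n) 1 1 y).charpoly.roots.filter (fun x => 0 < x)).card = 2 ∧
    ((Hess (F d n) 1 1 y).charpoly.roots.filter (fun x => x < 0)).card = 1 := by
  have hq : y ^ 2 = (2 * a - 1) / (2 - a) / 4 := by
    rw [hy, mul_pow, Real.sq_sqrt (div_nonneg (by linarith) (by linarith))]
    ring
  have h2a : 0 < 2 - a := by linarith
  have hy0 : 0 < y ^ 2 := by
    rw [hq]
    exact div_pos (div_pos (by linarith) h2a) (by norm_num)
  have hy1 : 4 * y ^ 2 < 1 := by
    have : (2 * a - 1) / (2 - a) < 1 := (div_lt_one h2a).2 (by linarith)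
    linarith
  have hn' : n = d * (1 - 4 * y ^ 2) / (1 + 2 * y ^ 2) := by
    rw [eq_div_iff (by positivity), hn, hq]
    field_simp
    ring
  have hn0 : 0 < n := by rw [hn]; exact mul_pos (by linarith) (by linarith)
  have hD : 0 < 1 - y ^ 2 := by linarith
  rw [hess_F_einstein hd hy1 hn' rfl rfl rfl]
  set k := (1 - y ^ 2) ^ (n / (d + 2 * n) - 2)
  set L := d * (1 - 4 * y ^ 2) / (4 * (1 - 2 * y ^ 2) * (1 + 2 * y ^ 2))
  have hk : 0 < k := Real.rpow_pos_of_pos hD _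
  have hL : 0 < L :=
    div_pos (mul_pos hd (by linarith)) (mul_pos (by linarith) (by positivity))
  refine ⟨?_, card_filter_roots_charpoly_of_swap_invariant ?_ ?_⟩
  · ext i j
    fin_cases i <;> fin_cases j <;> rfl
  · have : 0 < n / 4 * (1 - 2 * y ^ 2) * k :=
      mul_pos (mul_pos (by linarith) (by linarith)) hk
    linarith
  · have : 0 < 2 * n * y ^ 2 * (1 - y ^ 2) * L * k ^ 2 := by positivity
    linarith
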